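/- Let n ≥ 1 and L : Fin n → ℝ with L_i > 0 for all i. Let u : ℝ × (Fin n → ℝ) → ℂ (with coordinates (t,x)) be C^∞ and satisfy the heat equation ∂u/∂t = Σ_{i} ∂²u/∂x_i² at every point (t,x) with 0 ≤ x_i ≤ L_i for all i, together with the Dirichlet boundary conditions u(t,x) = 0 whenever there exists i with x_i ∈ {0, L_i} (and 0 ≤ x_h ≤ L_h for all h). For a multi-index j : Fin n → ℤ define b_j(t,x) = exp(−(Σ_i (j_i π / L_i)²) · t) · Π_i sin(j_i π x_i / L_i). Then for every compact set K ⊆ ℝ × Π_i [0,L_i], every m ∈ ℕ, and every ε > 0, there exist finitely many multi-indices j^{(1)}, …, j^{(r)} and coefficients c_1, …, c_r ∈ ℂ such that for every k ≤ m, the k-th iterated derivative of u − Σ_{h=1}^r c_h b_{j^{(h)}} has norm at most ε at every point of K. -/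

import Mathlib

/-- Partial derivative in the time variable. -/
noncomputable def dT {n : ℕ} (u : ℝ × (Fin n → ℝ) → ℂ) : ℝ × (Fin n → ℝ) → ℂ :=
  fun p => deriv (fun s => u (s, p.2)) p.1

/-- Partial derivative in the `i`-th space variable. -/
noncomputable def dX {n : ℕ} (i : Fin n) (u : ℝ × (Fin n → ℝ) → ℂ) : ℝ × (Fin n → ℝ) → ℂ :=
  fun p => deriv (fun s => u (p.1, Function.update p.2 i s)) (p.2 i)

/-- Separated B-EPGP basis element for the heat equation on the box `Π_i [0, L_i]` with
Dirichlet boundary conditions: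
`exp(−(Σ_i (j_i π/L_i)²) t) Π_i sin(j_i π x_i / L_i)`. -/
noncomputable def boxHeatBasis {n : ℕ} (L : Fin n → ℝ) (j : Fin n → ℤ) :
    ℝ × (Fin n → ℝ) → ℂ :=
  fun p => Complex.exp (((-(∑ i, ((j i : ℝ) * Real.pi / L i) ^ 2) * p.1 : ℝ) : ℂ)) *
    ∏ i, Complex.sin ((((j i : ℝ) * Real.pi * p.2 i / L i : ℝ) : ℂ))


open MeasureTheory Filter Topology

/-- The angular frequency `j_i π / L_i` of a box mode in the `i`-th variable. -/
noncomputable def boxFreq {n : ℕ} (L : Fin n → ℝ) (j : Fin n → ℤ) (i : Fin n) : ℝ :=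
  (j i : ℝ) * Real.pi / L i

/-- The Dirichlet eigenvalue `∑ i, (j_i π / L_i)²` of a box mode. -/
noncomputable def boxEigenvalue {n : ℕ} (L : Fin n → ℝ) (j : Fin n → ℤ) : ℝ :=
  ∑ i, boxFreq L j i ^ 2

/-- The spatial mode `∏ i, sin (j_i π x_i / L_i)`. -/
noncomputable def boxSine {n : ℕ} (L : Fin n → ℝ) (j : Fin n → ℤ) (x : Fin n → ℝ) : ℝ :=
  ∏ i, Real.sin (boxFreq L j i * x i)

theorem boxEigenvalue_nonneg {n : ℕ} (L : Fin n → ℝ) (j : Fin n → ℤ) : 0 ≤ boxEigenvalue L j :=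
  Finset.sum_nonneg fun _ _ => sq_nonneg _

theorem abs_boxSine_le_one {n : ℕ} (L : Fin n → ℝ) (j : Fin n → ℤ) (x : Fin n → ℝ) :
    |boxSine L j x| ≤ 1 := by
  rw [boxSine, Finset.abs_prod]
  exact Finset.prod_le_one (fun _ _ => abs_nonneg _) fun _ _ => Real.abs_sin_le_one _

theorem contDiff_boxSine {n : ℕ} (L : Fin n → ℝ) (j : Fin n → ℤ) {N : WithTop ℕ∞} :
    ContDiff ℝ N (boxSine L j) := by
  unfold boxSine
  fun_prop

theorem continuous_boxSine {n : ℕ} (L : Fin n → ℝ) (j : Fin n → ℤ) :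
    Continuous (boxSine L j) :=
  (contDiff_boxSine L j (N := 0)).continuous

theorem boxHeatBasis_eq {n : ℕ} (L : Fin n → ℝ) (j : Fin n → ℤ) (p : ℝ × (Fin n → ℝ)) :
    boxHeatBasis L j p =
      ((Real.exp (-boxEigenvalue L j * p.1) * boxSine L j p.2 : ℝ) : ℂ) := by
  simp only [boxHeatBasis, boxEigenvalue, boxSine, boxFreq, Complex.ofReal_mul,
    Complex.ofReal_exp, Complex.ofReal_prod, Complex.ofReal_sin]
  congr 1
  refine Finset.prod_congr rfl fun i _ => ?_
  rw [← Complex.ofReal_mul, div_mul_eq_mul_div]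

theorem contDiff_boxHeatBasis {n : ℕ} (L : Fin n → ℝ) (j : Fin n → ℤ) {N : WithTop ℕ∞} :
    ContDiff ℝ N (boxHeatBasis L j) := by
  rw [show boxHeatBasis L j = fun p => _ from funext (boxHeatBasis_eq L j)]
  exact Complex.ofRealCLM.contDiff.comp
    (ContDiff.mul (by fun_prop) ((contDiff_boxSine L j).comp contDiff_snd))

section DerivativeBounds

variable {E : Type*} [NormedAddCommGroup E] [NormedSpace ℝ E]

/-- Pointwise geometric bounds on iterated derivatives are multiplicative, the rates adding up. -/
theorem norm_iteratedFDeriv_mul_le_geometric {A : Type*} [NormedRing A] [NormedAlgebra ℝ A]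
    {f g : E → A} (hf : ContDiff ℝ (⊤ : ℕ∞) f) (hg : ContDiff ℝ (⊤ : ℕ∞) g) {x : E} {m : ℕ}
    {a b r s : ℝ} (ha : 0 ≤ a) (hr : 0 ≤ r)
    (hfx : ∀ k ≤ m, ‖iteratedFDeriv ℝ k f x‖ ≤ a * r ^ k)
    (hgx : ∀ k ≤ m, ‖iteratedFDeriv ℝ k g x‖ ≤ b * s ^ k) :
    ∀ k ≤ m, ‖iteratedFDeriv ℝ k (fun y => f y * g y) x‖ ≤ a * b * (r + s) ^ k := by
  intro k hk
  calc ‖iteratedFDeriv ℝ k (fun y => f y * g y) x‖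
      ≤ ∑ i ∈ Finset.range (k + 1), (k.choose i : ℝ) * ‖iteratedFDeriv ℝ i f x‖ *
          ‖iteratedFDeriv ℝ (k - i) g x‖ :=
        norm_iteratedFDeriv_mul_le hf hg x (mod_cast le_top)
    _ ≤ ∑ i ∈ Finset.range (k + 1), (k.choose i : ℝ) * (a * r ^ i) * (b * s ^ (k - i)) := by
        refine Finset.sum_le_sum fun i hi => ?_
        have hik : i ≤ k := Nat.lt_succ_iff.mp (Finset.mem_range.mp hi)
        have h1 := hfx i (hik.trans hk)
        have h2 := hgx (k - i) ((Nat.sub_le k i).trans hk)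
        gcongr
    _ = a * b * (r + s) ^ k := by
        rw [add_pow, Finset.mul_sum]
        exact Finset.sum_congr rfl fun i _ => by ring

theorem norm_iteratedFDeriv_prod_le_geometric {A ι : Type*} [NormedCommRing A]
    [NormedAlgebra ℝ A] [NormOneClass A] (t : Finset ι)
    {f : ι → E → A} (hf : ∀ i, ContDiff ℝ (⊤ : ℕ∞) (f i)) {x : E} {m : ℕ} {r : ι → ℝ}
    (hr : ∀ i, 0 ≤ r i) (hfx : ∀ i, ∀ k ≤ m, ‖iteratedFDeriv ℝ k (f i) x‖ ≤ r i ^ k) :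
    ∀ k ≤ m, ‖iteratedFDeriv ℝ k (fun y => ∏ i ∈ t, f i y) x‖ ≤ (∑ i ∈ t, r i) ^ k := by
  classical
  induction t using Finset.induction_on with
  | empty =>
    intro k _
    rcases Nat.eq_zero_or_pos k with rfl | hk
    · simp
    · simp [iteratedFDeriv_const_of_ne hk.ne', hk.ne']
  | insert i t hi ih =>
    intro k hk
    simp only [Finset.prod_insert hi, Finset.sum_insert hi]
    have := norm_iteratedFDeriv_mul_le_geometric (hf i)
      (contDiff_prod fun i _ => hf i : ContDiff ℝ (⊤ : ℕ∞) fun y => ∏ i ∈ t, f i y)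
      zero_le_one (hr i) (fun k hk => by simpa using hfx i k hk)
      (b := 1) (fun k hk => by simpa using ih k hk) k hk
    simpa using this

/-- Precomposing a function of one real variable with a functional of norm at most one does not
increase the norm of its iterated derivatives. -/
theorem norm_iteratedFDeriv_comp_functional_le {F : Type*} [NormedAddCommGroup F]
    [NormedSpace ℝ F] {h : ℝ → F} (hh : ContDiff ℝ (⊤ : ℕ∞) h) (l : E →L[ℝ] ℝ) (hl : ‖l‖ ≤ 1)
    (k : ℕ) (x : E) :
    ‖iteratedFDeriv ℝ k (fun y => h (l y)) x‖ ≤ ‖iteratedDeriv k h (l x)‖ := by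
  have : (fun y => h (l y)) = h ∘ l := rfl
  rw [this, l.iteratedFDeriv_comp_right hh x (mod_cast le_top : (k : WithTop ℕ∞) ≤ _),
    ← norm_iteratedFDeriv_eq_norm_iteratedDeriv]
  refine (ContinuousMultilinearMap.norm_compContinuousLinearMap_le _ _).trans ?_
  simpa using mul_le_of_le_one_right (norm_nonneg _) (pow_le_one₀ (norm_nonneg l) hl)

end DerivativeBounds

theorem norm_iteratedFDeriv_boxHeatBasis_le {n : ℕ} (L : Fin n → ℝ) (j : Fin n → ℤ)
    (p : ℝ × (Fin n → ℝ)) (k : ℕ) :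
    ‖iteratedFDeriv ℝ k (boxHeatBasis L j) p‖ ≤ Real.exp (-boxEigenvalue L j * p.1) *
      (boxEigenvalue L j + ∑ i, |boxFreq L j i|) ^ k := by
  have hexp : ContDiff ℝ (⊤ : ℕ∞) fun t : ℝ => Real.exp (-boxEigenvalue L j * t) := by fun_prop
  have hsin (i : Fin n) : ContDiff ℝ (⊤ : ℕ∞) fun t : ℝ => Real.sin (boxFreq L j i * t) := by
    fun_prop
  let proj (i : Fin n) : ℝ × (Fin n → ℝ) →L[ℝ] ℝ :=
    (ContinuousLinearMap.proj i).comp (ContinuousLinearMap.snd ℝ ℝ (Fin n → ℝ))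
  have hproj (i : Fin n) : ‖proj i‖ ≤ 1 :=
    ContinuousLinearMap.opNorm_le_bound _ zero_le_one fun q => by
      simpa [proj] using (norm_le_pi_norm q.2 i).trans (norm_snd_le q)
  have hprod := norm_iteratedFDeriv_prod_le_geometric (m := k) Finset.univ
    (f := fun i (q : ℝ × (Fin n → ℝ)) => Real.sin (boxFreq L j i * q.2 i)) (x := p)
    (r := fun i => |boxFreq L j i|) (fun i => by fun_prop) (fun i => abs_nonneg _) fun i l _ => by
      refine (norm_iteratedFDeriv_comp_functional_le (hsin i) (proj i) (hproj i) l p).trans ?_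
      rw [iteratedDeriv_comp_const_mul (Real.contDiff_sin.of_le le_top), norm_mul, norm_pow,
        Real.norm_eq_abs]
      exact mul_le_of_le_one_right (by positivity) (Real.abs_iteratedDeriv_sin_le_one l _)
  have hmul := norm_iteratedFDeriv_mul_le_geometric (m := k) (x := p)
    (f := fun q : ℝ × (Fin n → ℝ) => Real.exp (-boxEigenvalue L j * q.1))
    (by fun_prop) (by fun_prop) (Real.exp_nonneg (-boxEigenvalue L j * p.1))
    (boxEigenvalue_nonneg L j) (fun l _ => by
      refine (norm_iteratedFDeriv_comp_functional_le hexp (ContinuousLinearMap.fst ℝ ℝ (Fin n → ℝ))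
        (ContinuousLinearMap.norm_fst_le ..) l p).trans ?_
      rw [iteratedDeriv_exp_const_mul, norm_mul, norm_pow, norm_neg, Real.norm_eq_abs,
        Real.norm_eq_abs, abs_of_nonneg (boxEigenvalue_nonneg L j), Real.abs_exp, mul_comm]
      rfl)
    (fun l hl => (hprod l hl).trans_eq (one_mul _).symm) k le_rfl
  rw [mul_one] at hmul
  rw [show boxHeatBasis L j = Complex.ofRealLI ∘ fun p => _ from funext (boxHeatBasis_eq L j),
    LinearIsometry.norm_iteratedFDeriv_comp_left (n := (⊤ : ℕ∞)) _ _ (mod_cast le_top)]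
  · exact hmul
  · exact (ContDiff.mul (by fun_prop) ((contDiff_boxSine L j).comp contDiff_snd)).contDiffAt

section Green

variable {n : ℕ} {u v : ℝ × (Fin n → ℝ) → ℂ}

theorem dT_eq_fderiv (hu : Differentiable ℝ u) (p : ℝ × (Fin n → ℝ)) :
    dT u p = fderiv ℝ u p (1, 0) := by
  have h : HasDerivAt (fun s : ℝ => (s, p.2)) (1, 0) p.1 :=
    (hasDerivAt_id p.1).prodMk (hasDerivAt_const p.1 p.2)
  exact ((hu p).hasFDerivAt.comp_hasDerivAt p.1 h).deriv

theorem dX_eq_fderiv (hu : Differentiable ℝ u) (i : Fin n) (p : ℝ × (Fin n → ℝ)) :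
    dX i u p = fderiv ℝ u p (0, Pi.single i 1) := by
  have h : HasDerivAt (fun s : ℝ => (p.1, Function.update p.2 i s)) (0, Pi.single i 1) (p.2 i) :=
    (hasDerivAt_const (p.2 i) p.1).prodMk (hasDerivAt_update p.2 i (p.2 i))
  have hp : HasFDerivAt u (fderiv ℝ u p) (p.1, Function.update p.2 i (p.2 i)) := by
    simpa using (hu p).hasFDerivAt
  exact (hp.comp_hasDerivAt (p.2 i) h).deriv

theorem contDiff_dX (hu : ContDiff ℝ (⊤ : ℕ∞) u) (i : Fin n) :
    ContDiff ℝ (⊤ : ℕ∞) (dX i u) := by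
  rw [show dX i u = fun p => fderiv ℝ u p (0, Pi.single i 1) from
    funext (dX_eq_fderiv (hu.differentiable (by simp)) i)]
  exact (hu.fderiv_right (m := (⊤ : ℕ∞)) (by simp)).clm_apply contDiff_const

/-- The spatial pairing of a solution of the heat equation with a solution of the backward heat
equation, both vanishing on the faces of the box, does not depend on time. -/
theorem setIntegral_mul_eq_of_heat {a b : Fin n → ℝ} (hab : a ≤ b)
    (hu : ContDiff ℝ (⊤ : ℕ∞) u) (hv : ContDiff ℝ (⊤ : ℕ∞) v)
    (hu' : ∀ t, ∀ x ∈ Set.Icc a b, dT u (t, x) = ∑ i, dX i (dX i u) (t, x))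
    (hv' : ∀ t, ∀ x ∈ Set.Icc a b, dT v (t, x) = -∑ i, dX i (dX i v) (t, x))
    (hu0 : ∀ t, ∀ x ∈ Set.Icc a b, (∃ i, x i = a i ∨ x i = b i) → u (t, x) = 0)
    (hv0 : ∀ t, ∀ x ∈ Set.Icc a b, (∃ i, x i = a i ∨ x i = b i) → v (t, x) = 0)
    {s t : ℝ} (hst : s ≤ t) :
    ∫ x in Set.Icc a b, u (t, x) * v (t, x) = ∫ x in Set.Icc a b, u (s, x) * v (s, x) := by
  let e : (Fin (n + 1) → ℝ) →L[ℝ] ℝ × (Fin n → ℝ) :=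
    (ContinuousLinearMap.proj 0).prod (ContinuousLinearMap.pi fun i : Fin n =>
      ContinuousLinearMap.proj i.succ)
  let F : Fin (n + 1) → ℝ × (Fin n → ℝ) → ℂ :=
    Fin.cons (fun q => u q * v q) fun i q => u q * dX i v q - dX i u q * v q
  have hud := hu.differentiable (by simp)
  have hvd := hv.differentiable (by simp)
  have hudX (i : Fin n) := (contDiff_dX hu i).differentiable (by simp)
  have hvdX (i : Fin n) := (contDiff_dX hv i).differentiable (by simp)
  have hF (i : Fin (n + 1)) : Differentiable ℝ (F i) := by
    refine Fin.cases ?_ (fun i => ?_) i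
    · exact hud.mul hvd
    · exact (hud.mul (hvdX i)).sub ((hudX i).mul hvd)
  have he0 : e (Pi.single 0 1) = (1, 0) := by
    ext i <;> simp [e]
  have hei (i : Fin n) : e (Pi.single i.succ 1) = (0, Pi.single i 1) := by
    ext k
    · simp [e]
    · simp [e, Pi.single_apply]
  have hab' : (Fin.cons s a : Fin (n + 1) → ℝ) ≤ Fin.cons t b := Fin.cons_le_cons.2 ⟨hst, hab⟩
  have hmem {x : Fin (n + 1) → ℝ} (hx : x ∈ Set.Icc (Fin.cons s a : Fin (n + 1) → ℝ)
      (Fin.cons t b)) : (e x).2 ∈ Set.Icc a b :=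
    ⟨fun i => by simpa [e] using hx.1 i.succ, fun i => by simpa [e] using hx.2 i.succ⟩
  have hdiv {x : Fin (n + 1) → ℝ} (hx : x ∈ Set.Icc (Fin.cons s a : Fin (n + 1) → ℝ)
      (Fin.cons t b)) : ∑ i, (fderiv ℝ (F i) (e x)).comp e (Pi.single i 1) = 0 := by
    have h1 := hu' (e x).1 _ (hmem hx)
    have h2 := hv' (e x).1 _ (hmem hx)
    rw [Prod.mk.eta, dT_eq_fderiv hud] at h1
    rw [Prod.mk.eta, dT_eq_fderiv hvd] at h2
    have hsucc (i : Fin n) : fderiv ℝ (F i.succ) (e x) (0, Pi.single i 1) =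
        u (e x) * dX i (dX i v) (e x) - v (e x) * dX i (dX i u) (e x) := by
      have : F i.succ = (u * dX i v) - (dX i u * v) := rfl
      rw [this, fderiv_sub ((hud _).mul (hvdX i _)) ((hudX i _).mul (hvd _)),
        fderiv_mul (hud _) (hvdX i _), fderiv_mul (hudX i _) (hvd _),
        dX_eq_fderiv (hvdX i), dX_eq_fderiv (hudX i)]
      simp only [_root_.sub_apply, _root_.add_apply,
        _root_.smul_apply, smul_eq_mul, ← dX_eq_fderiv hud, ← dX_eq_fderiv hvd]
      ring
    have hzero : fderiv ℝ (F 0) (e x) (1, 0) =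
        u (e x) * fderiv ℝ v (e x) (1, 0) + v (e x) * fderiv ℝ u (e x) (1, 0) := by
      have : F 0 = u * v := rfl
      rw [this, fderiv_mul (hud _) (hvd _)]
      simp
    simp only [ContinuousLinearMap.comp_apply, Fin.sum_univ_succ, he0, hei, hsucc, hzero, h1, h2,
      Finset.sum_sub_distrib, ← Finset.mul_sum]
    ring
  have hface (i : Fin n) {y : ℝ} (hy : y = a i ∨ y = b i) (hy' : y ∈ Set.Icc (a i) (b i)) :
      ∫ x in Set.Icc ((Fin.cons s a : Fin (n + 1) → ℝ) ∘ i.succ.succAbove)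
        ((Fin.cons t b : Fin (n + 1) → ℝ) ∘ i.succ.succAbove),
        F i.succ (e (i.succ.insertNth y x)) = 0 := by
    refine setIntegral_eq_zero_of_forall_eq_zero fun x hx => ?_
    have hm := hmem (Fin.insertNth_mem_Icc.2 ⟨by simpa using hy', hx⟩)
    have hb : ∃ k, (e (i.succ.insertNth y x)).2 k = a k ∨
        (e (i.succ.insertNth y x)).2 k = b k := ⟨i, by simpa [e] using hy⟩
    have h1 : u (e (i.succ.insertNth y x)) = 0 := hu0 _ _ hm hb
    have h2 : v (e (i.succ.insertNth y x)) = 0 := hv0 _ _ hm hb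
    simp [F, h1, h2]
  have key := integral_divergence_of_hasFDerivAt_off_countable' (Fin.cons s a : Fin (n + 1) → ℝ)
    (Fin.cons t b) hab' (fun i x => F i (e x)) (fun i x => (fderiv ℝ (F i) (e x)).comp e) ∅
    Set.countable_empty (fun i => ((hF i).continuous.comp e.continuous).continuousOn)
    (fun x _ i => (hF i (e x)).hasFDerivAt.comp x e.hasFDerivAt)
    (integrableOn_zero.congr_fun (fun x hx => (hdiv hx).symm) measurableSet_Icc)
  rw [setIntegral_eq_zero_of_forall_eq_zero fun x hx => hdiv hx, Fin.sum_univ_succ,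
    Finset.sum_eq_zero fun i _ => by
      rw [Fin.cons_succ, Fin.cons_succ, hface i (.inr rfl) ⟨hab i, le_rfl⟩,
        hface i (.inl rfl) ⟨le_rfl, hab i⟩, sub_zero], add_zero] at key
  have h0 (y : ℝ) (x : Fin n → ℝ) : e ((0 : Fin (n + 1)).insertNth y x) = (y, x) := by
    ext i <;> simp [e]
  simp only [h0] at key
  exact sub_eq_zero.1 key.symm

end Green

section Coefficients

variable {n : ℕ} {L : Fin n → ℝ}

theorem boxFreq_mul_length (hL : ∀ i, 0 < L i) (j : Fin n → ℤ) (i : Fin n) :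
    boxFreq L j i * L i = j i * Real.pi :=
  div_mul_cancel₀ _ (hL i).ne'

theorem boxSine_eq_zero_of_face (hL : ∀ i, 0 < L i) (j : Fin n → ℤ) {x : Fin n → ℝ}
    (hx : ∃ i, x i = 0 ∨ x i = L i) : boxSine L j x = 0 := by
  obtain ⟨i, hi⟩ := hx
  refine Finset.prod_eq_zero (Finset.mem_univ i) ?_
  rcases hi with hi | hi
  · simp [hi]
  · rw [hi, boxFreq_mul_length hL, Real.sin_int_mul_pi]

theorem boxSine_update (L : Fin n → ℝ) (j : Fin n → ℤ) (x : Fin n → ℝ) (i : Fin n) (s : ℝ) :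
    boxSine L j (Function.update x i s) = Real.sin (boxFreq L j i * s) *
      ∏ k ∈ Finset.univ.erase i, Real.sin (boxFreq L j k * x k) := by
  rw [boxSine, ← Finset.mul_prod_erase _ _ (Finset.mem_univ i), Function.update_self]
  congr 1
  refine Finset.prod_congr rfl fun k hk => ?_
  rw [Function.update_of_ne (Finset.ne_of_mem_erase hk)]

theorem dX_dX (u : ℝ × (Fin n → ℝ) → ℂ) (i : Fin n) (p : ℝ × (Fin n → ℝ)) :
    dX i (dX i u) p = deriv (deriv fun s => u (p.1, Function.update p.2 i s)) (p.2 i) := by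
  simp [dX]

theorem deriv_deriv_sin_mul (c : ℝ) (d : ℂ) :
    deriv (deriv fun s : ℝ => (Real.sin (c * s) : ℂ) * d) =
      fun s => -(c : ℂ) ^ 2 * ((Real.sin (c * s) : ℂ) * d) := by
  have hlin (s : ℝ) : HasDerivAt (fun s : ℝ => c * s) c s := by
    simpa using (hasDerivAt_id s).const_mul c
  have h1 : deriv (fun s : ℝ => (Real.sin (c * s) : ℂ) * d) =
      fun s => ((Real.cos (c * s) * c : ℝ) : ℂ) * d :=
    funext fun s => ((hlin s).sin.ofReal_comp.mul_const d).deriv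
  rw [h1]
  funext s
  rw [(((hlin s).cos.mul_const c).ofReal_comp.mul_const d).deriv]
  push_cast
  ring

/-- Time reversal turns a separated solution of the heat equation into a solution of the backward
heat equation. -/
theorem dT_boxHeatBasis_neg (L : Fin n → ℝ) (j : Fin n → ℤ) (p : ℝ × (Fin n → ℝ)) :
    dT (fun q => boxHeatBasis L j (-q.1, q.2)) p =
      -∑ i, dX i (dX i fun q => boxHeatBasis L j (-q.1, q.2)) p := by
  have hT : dT (fun q => boxHeatBasis L j (-q.1, q.2)) p =
      boxEigenvalue L j * boxHeatBasis L j (-p.1, p.2) := by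
    have hlin : HasDerivAt (fun s : ℝ => -boxEigenvalue L j * -s) (boxEigenvalue L j) p.1 := by
      simpa using (hasDerivAt_id p.1).const_mul (boxEigenvalue L j)
    simp only [dT, boxHeatBasis_eq]
    rw [((hlin.exp.mul_const (boxSine L j p.2)).ofReal_comp).deriv]
    push_cast
    ring
  have hX (i : Fin n) : dX i (dX i fun q => boxHeatBasis L j (-q.1, q.2)) p =
      -(boxFreq L j i : ℂ) ^ 2 * boxHeatBasis L j (-p.1, p.2) := by
    have hsep (s : ℝ) : boxHeatBasis L j (-p.1, Function.update p.2 i s) =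
        (Real.sin (boxFreq L j i * s) : ℂ) * ((Real.exp (-boxEigenvalue L j * -p.1) *
          ∏ k ∈ Finset.univ.erase i, Real.sin (boxFreq L j k * p.2 k) : ℝ) : ℂ) := by
      rw [boxHeatBasis_eq, boxSine_update]
      push_cast
      ring
    rw [dX_dX]
    simp only [hsep, deriv_deriv_sin_mul]
    rw [← hsep, Function.update_eq_self]
  simp only [hT, hX, ← Finset.sum_mul, boxEigenvalue, Complex.ofReal_sum, Complex.ofReal_pow,
    Finset.sum_neg_distrib]
  ring

/-- The unnormalised Dirichlet sine coefficients of a function on the box `∏ i, [0, L i]`. -/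
noncomputable def boxCoeff (L : Fin n → ℝ) (f : (Fin n → ℝ) → ℂ) (j : Fin n → ℤ) : ℂ :=
  ∫ x in Set.Icc 0 L, f x * (boxSine L j x : ℂ)

theorem boxCoeff_heat (hL : ∀ i, 0 < L i) {u : ℝ × (Fin n → ℝ) → ℂ}
    (hu : ContDiff ℝ (⊤ : ℕ∞) u)
    (hheat : ∀ t, ∀ x ∈ Set.Icc 0 L, dT u (t, x) = ∑ i, dX i (dX i u) (t, x))
    (hbc : ∀ t, ∀ x ∈ Set.Icc 0 L, (∃ i, x i = 0 ∨ x i = L i) → u (t, x) = 0)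
    (j : Fin n → ℤ) (s t : ℝ) :
    boxCoeff L (fun x => u (t, x)) j =
      Real.exp (-boxEigenvalue L j * (t - s)) * boxCoeff L (fun x => u (s, x)) j := by
  have hconst {s t : ℝ} (hst : s ≤ t) :
      Real.exp (boxEigenvalue L j * t) * boxCoeff L (fun x => u (t, x)) j =
        Real.exp (boxEigenvalue L j * s) * boxCoeff L (fun x => u (s, x)) j := by
    have h := setIntegral_mul_eq_of_heat (a := 0) (v := fun q => boxHeatBasis L j (-q.1, q.2))
      (fun i => (hL i).le) hu
      ((contDiff_boxHeatBasis L j).comp (contDiff_fst.neg.prodMk contDiff_snd)) hheat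
      (fun t x _ => dT_boxHeatBasis_neg L j (t, x)) hbc
      (fun t x _ hx => by
        rw [boxHeatBasis_eq, boxSine_eq_zero_of_face hL j hx, mul_zero, Complex.ofReal_zero]) hst
    have hsplit (t : ℝ) : ∫ x in Set.Icc 0 L, u (t, x) * boxHeatBasis L j (-t, x) =
        Real.exp (boxEigenvalue L j * t) * boxCoeff L (fun x => u (t, x)) j := by
      rw [boxCoeff, ← integral_const_mul]
      congr 1
      funext x
      rw [boxHeatBasis_eq, neg_mul_neg]
      push_cast
      ring
    exact (hsplit t).symm.trans (h.trans (hsplit s))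
  have h : Real.exp (boxEigenvalue L j * t) * boxCoeff L (fun x => u (t, x)) j =
      Real.exp (boxEigenvalue L j * s) * boxCoeff L (fun x => u (s, x)) j :=
    (le_total s t).elim hconst fun hts => (hconst hts).symm
  have hexp : Real.exp (-boxEigenvalue L j * (t - s)) =
      Real.exp (-(boxEigenvalue L j * t)) * Real.exp (boxEigenvalue L j * s) := by
    rw [← Real.exp_add]
    ring_nf
  rw [hexp, Complex.ofReal_mul, mul_assoc, ← h, ← mul_assoc, ← Complex.ofReal_mul,
    ← Real.exp_add, neg_add_cancel, Real.exp_zero, Complex.ofReal_one, one_mul]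

end Coefficients

section Completeness

variable {n : ℕ} {L : Fin n → ℝ}

theorem boxSine_update_index (L : Fin n → ℝ) (j : Fin n → ℤ) (x : Fin n → ℝ) (i : Fin n) (k : ℤ) :
    boxSine L (Function.update j i k) x = Real.sin (k * Real.pi / L i * x i) *
      ∏ l ∈ Finset.univ.erase i, Real.sin (boxFreq L j l * x l) := by
  rw [boxSine, ← Finset.mul_prod_erase _ _ (Finset.mem_univ i), boxFreq, Function.update_self]
  congr 1
  refine Finset.prod_congr rfl fun l hl => ?_
  rw [boxFreq, Function.update_of_ne (Finset.ne_of_mem_erase hl), boxFreq]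

theorem cos_mul_boxSine (L : Fin n → ℝ) (j : Fin n → ℤ) (x : Fin n → ℝ) (i : Fin n) :
    Real.cos (Real.pi / L i * x i) * boxSine L j x =
      (boxSine L (Function.update j i (j i + 1)) x +
        boxSine L (Function.update j i (j i - 1)) x) / 2 := by
  have h := boxSine_update_index L j x i (j i)
  rw [Function.update_eq_self] at h
  rw [h, boxSine_update_index, boxSine_update_index, Int.cast_add, Int.cast_sub, Int.cast_one,
    show ((j i : ℝ) + 1) * Real.pi / L i * x i =
      j i * Real.pi / L i * x i + Real.pi / L i * x i by ring,
    show ((j i : ℝ) - 1) * Real.pi / L i * x i =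
      j i * Real.pi / L i * x i - Real.pi / L i * x i by ring, Real.sin_add, Real.sin_sub]
  ring

/-- If all sine coefficients of `f` vanish, then `f` times any sine mode is orthogonal to all
continuous functions on the box. -/
theorem integral_smul_boxSine_eq_zero (hL : ∀ i, 0 < L i) {f : (Fin n → ℝ) → ℂ}
    (hf : Continuous f) (h : ∀ j, boxCoeff L f j = 0) (g : C(Set.Icc 0 L, ℝ)) (j : Fin n → ℤ) :
    ∫ x : Set.Icc 0 L, g x • (f x * (boxSine L j x : ℂ))
      ∂(Measure.comap Subtype.val volume) = 0 := by
  set μ : Measure (Set.Icc 0 L) := Measure.comap Subtype.val volume with hμ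
  have hfin : IsFiniteMeasure μ :=
    ⟨by
      rw [hμ, comap_subtype_coe_apply measurableSet_Icc, Set.image_univ, Subtype.range_coe]
      exact isCompact_Icc.measure_lt_top⟩
  have hcont (j : Fin n → ℤ) :
      Continuous fun x : Set.Icc 0 L => f x * (boxSine L j x : ℂ) := by
    have := continuous_boxSine L j
    fun_prop
  have hint {q : Set.Icc 0 L → ℂ} (hq : Continuous q) : Integrable q μ :=
    hq.integrable_of_hasCompactSupport (HasCompactSupport.of_compactSpace q)
  have hintg (g : C(Set.Icc 0 L, ℝ)) (j : Fin n → ℤ) :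
      Integrable (fun x : Set.Icc 0 L => g x • (f x * (boxSine L j x : ℂ))) μ :=
    hint (g.continuous.smul (hcont j))
  let Λ (j : Fin n → ℤ) : C(Set.Icc 0 L, ℝ) →L[ℝ] ℂ := LinearMap.mkContinuous
    { toFun := fun g => ∫ x : Set.Icc 0 L, g x • (f x * (boxSine L j x : ℂ)) ∂μ
      map_add' := fun a b => by
        simp only [ContinuousMap.add_apply, add_smul]
        exact integral_add (hintg a j) (hintg b j)
      map_smul' := fun c a => by
        simp only [ContinuousMap.smul_apply, smul_assoc, RingHom.id_apply]
        exact integral_smul c _ }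
    (∫ x : Set.Icc 0 L, ‖f x * (boxSine L j x : ℂ)‖ ∂μ) fun g => by
      refine (norm_integral_le_of_norm_le (((hint (hcont j)).norm).const_mul ‖g‖)
        (Eventually.of_forall fun x => ?_)).trans_eq ?_
      · rw [norm_smul]
        gcongr
        exact g.norm_coe_le_norm x
      · rw [integral_const_mul, mul_comm]
  let A : Subalgebra ℝ C(Set.Icc 0 L, ℝ) :=
    { carrier := {a | ∀ g, (∀ j, Λ j g = 0) → ∀ j, Λ j (a * g) = 0}
      mul_mem' := fun {a b} ha hb g hg => by
        simpa only [mul_assoc] using ha (b * g) (hb g hg)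
      add_mem' := fun {a b} ha hb g hg j => by
        rw [add_mul, map_add, ha g hg, hb g hg, add_zero]
      algebraMap_mem' := fun r g hg j => by
        rw [← Algebra.smul_def, map_smul, hg, smul_zero] }
  have hA : IsClosed (A : Set C(Set.Icc 0 L, ℝ)) := by
    have : (A : Set C(Set.Icc 0 L, ℝ)) =
        ⋂ g, ⋂ (_ : ∀ j, Λ j g = 0), ⋂ j, {a | Λ j (a * g) = 0} := by
      ext a
      simp [A]
    rw [this]
    exact isClosed_iInter fun g => isClosed_iInter fun _ => isClosed_iInter fun j =>
      isClosed_eq ((Λ j).continuous.comp (continuous_id.mul continuous_const)) continuous_const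
  have hcosc (i : Fin n) : Continuous fun x : Set.Icc 0 L => Real.cos (Real.pi / L i * x.1 i) :=
    Real.continuous_cos.comp
      (continuous_const.mul ((continuous_apply i).comp continuous_subtype_val))
  have hcos (i : Fin n) :
      (⟨fun x => Real.cos (Real.pi / L i * x.1 i), hcosc i⟩ : C(Set.Icc 0 L, ℝ)) ∈ A := by
    intro g hg j
    have h1 := hg (Function.update j i (j i + 1))
    have h2 := hg (Function.update j i (j i - 1))
    have : Λ j (⟨fun x => Real.cos (Real.pi / L i * x.1 i), hcosc i⟩ * g) =
        (Λ (Function.update j i (j i + 1)) g + Λ (Function.update j i (j i - 1)) g) / 2 := by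
      simp only [Λ, LinearMap.mkContinuous_apply, LinearMap.coe_mk, AddHom.coe_mk]
      rw [← integral_add (hintg g _) (hintg g _), ← integral_div]
      congr 1
      funext x
      have hx := congrArg (Complex.ofReal) (cos_mul_boxSine L j x i)
      push_cast at hx
      simp only [ContinuousMap.mul_apply, ContinuousMap.coe_mk, Complex.real_smul,
        Complex.ofReal_mul, Complex.ofReal_cos, Complex.ofReal_div]
      linear_combination (g x : ℂ) * f x * hx
    rw [this, h1, h2, add_zero, zero_div]
  have hsep : A.SeparatesPoints := by
    intro x y hxy
    obtain ⟨i, hi⟩ := Function.ne_iff.1 (Subtype.coe_injective.ne hxy)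
    refine ⟨_, ⟨_, hcos i, rfl⟩, fun hc => hi ?_⟩
    have hmem (z : Set.Icc 0 L) : Real.pi / L i * z.1 i ∈ Set.Icc 0 Real.pi := by
      have h0 : 0 ≤ z.1 i := z.2.1 i
      have h1 : z.1 i ≤ L i := z.2.2 i
      have := hL i
      refine ⟨by positivity, ?_⟩
      rw [div_mul_eq_mul_div, div_le_iff₀ this]
      gcongr
    exact mul_left_cancel₀ (div_ne_zero Real.pi_ne_zero (hL i).ne')
      (Real.injOn_cos (hmem x) (hmem y) hc)
  have htop : g ∈ A := by
    have hmem : g ∈ A.topologicalClosure := by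
      rw [ContinuousMap.subalgebra_topologicalClosure_eq_top_of_separatesPoints A hsep]
      trivial
    exact hA.closure_subset hmem
  have hone (j : Fin n → ℤ) : Λ j 1 = 0 := by
    have hj := h j
    rw [boxCoeff, ← integral_subtype_comap measurableSet_Icc] at hj
    simpa [Λ] using hj
  have := htop 1 hone j
  rwa [mul_one] at this

/-- The Dirichlet sine modes are complete: a continuous function all of whose sine coefficients
vanish is zero in the open box. -/
theorem eq_zero_of_boxCoeff_eq_zero (hL : ∀ i, 0 < L i) {f : (Fin n → ℝ) → ℂ}
    (hf : Continuous f) (h : ∀ j, boxCoeff L f j = 0) {x : Fin n → ℝ}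
    (hx : x ∈ Set.univ.pi fun i => Set.Ioo 0 (L i)) : f x = 0 := by
  have hU : IsOpen (Set.univ.pi fun i => Set.Ioo 0 (L i)) :=
    isOpen_set_pi Set.finite_univ fun _ _ => isOpen_Ioo
  have hUsub : (Set.univ.pi fun i => Set.Ioo 0 (L i)) ⊆ Set.Icc 0 L := fun y hy =>
    ⟨fun i => (hy i trivial).1.le, fun i => (hy i trivial).2.le⟩
  have hcont : Continuous fun x => f x * (boxSine L 1 x : ℂ) := by
    have := continuous_boxSine L 1
    fun_prop
  have hae := hU.ae_eq_zero_of_integral_contDiff_smul_eq_zero (μ := volume)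
    (hcont.locallyIntegrable.locallyIntegrableOn _) fun g hg _ hgU => by
      rw [← setIntegral_eq_integral_of_forall_compl_eq_zero (s := Set.Icc 0 L) fun y hy => by
        rw [image_eq_zero_of_notMem_tsupport fun hy' => hy (hUsub (hgU hy')), zero_smul],
        ← integral_subtype_comap measurableSet_Icc]
      exact integral_smul_boxSine_eq_zero hL hf h
        ⟨fun y => g y, hg.continuous.comp continuous_subtype_val⟩ 1
  have hzero := Measure.eqOn_open_of_ae_eq
    (show (fun x => f x * (boxSine L 1 x : ℂ)) =ᵐ[volume.restrict
      (Set.univ.pi fun i => Set.Ioo 0 (L i))] fun _ => 0 from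
      (ae_restrict_iff' hU.measurableSet).2 hae) hU hcont.continuousOn continuousOn_const hx
  refine (mul_eq_zero.1 hzero).resolve_right ?_
  rw [Complex.ofReal_eq_zero, ← ne_eq, boxSine, Finset.prod_ne_zero_iff]
  intro i _
  have hi := hx i trivial
  have hfreq : boxFreq L 1 i * L i = Real.pi := by simp [boxFreq_mul_length hL]
  have hpos : 0 < boxFreq L 1 i := by
    simpa [boxFreq] using div_pos Real.pi_pos (hL i)
  refine (Real.sin_pos_of_pos_of_lt_pi (mul_pos hpos hi.1) ?_).ne'
  exact (mul_lt_mul_of_pos_left hi.2 hpos).trans_eq hfreq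

end Completeness

section SineSeries

variable {n : ℕ} {L : Fin n → ℝ}

theorem integral_cos_int_mul_pi_div {l : ℝ} (hl : 0 < l) (k : ℤ) :
    ∫ x in (0 : ℝ)..l, Real.cos (k * Real.pi / l * x) = if k = 0 then l else 0 := by
  split_ifs with hk
  · simp [hk]
  · have hc : (k : ℝ) * Real.pi / l ≠ 0 :=
      div_ne_zero (mul_ne_zero (Int.cast_ne_zero.2 hk) Real.pi_ne_zero) hl.ne'
    rw [intervalIntegral.integral_comp_mul_left (fun x => Real.cos x) hc, integral_cos, mul_zero,
      Real.sin_zero, div_mul_cancel₀ _ hl.ne', Real.sin_int_mul_pi, sub_zero, smul_zero]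

theorem integral_sin_mul_sin_pi_div {l : ℝ} (hl : 0 < l) (a b : ℤ) :
    ∫ x in (0 : ℝ)..l, Real.sin (a * Real.pi / l * x) * Real.sin (b * Real.pi / l * x) =
      ((if a - b = 0 then l else 0) - if a + b = 0 then l else 0) / 2 := by
  rw [← integral_cos_int_mul_pi_div hl, ← integral_cos_int_mul_pi_div hl,
    ← intervalIntegral.integral_sub (Continuous.intervalIntegrable (by fun_prop) ..)
      (Continuous.intervalIntegrable (by fun_prop) ..), ← intervalIntegral.integral_div]
  congr 1
  funext x
  rw [show ((a - b : ℤ) : ℝ) * Real.pi / l * x = a * Real.pi / l * x - b * Real.pi / l * x by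
      push_cast; ring,
    show ((a + b : ℤ) : ℝ) * Real.pi / l * x = a * Real.pi / l * x + b * Real.pi / l * x by
      push_cast; ring, Real.cos_sub, Real.cos_add]
  ring

theorem setIntegral_boxSine_mul_boxSine (hL : ∀ i, 0 < L i) (a b : Fin n → ℤ) :
    ∫ x in Set.Icc 0 L, boxSine L a x * boxSine L b x =
      ∏ i, ((if a i - b i = 0 then L i else 0) - if a i + b i = 0 then L i else 0) / 2 := by
  rw [← Set.pi_univ_Icc, volume_pi, Measure.restrict_pi_pi]
  simp only [boxSine, ← Finset.prod_mul_distrib]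
  rw [integral_fintype_prod_eq_prod
    (fun i y => Real.sin (boxFreq L a i * y) * Real.sin (boxFreq L b i * y))]
  refine Finset.prod_congr rfl fun i _ => ?_
  rw [integral_Icc_eq_integral_Ioc, ← intervalIntegral.integral_of_le (by exact (hL i).le)]
  exact integral_sin_mul_sin_pi_div (hL i) (a i) (b i)

theorem integrableOn_box_mul_boxSine {f : (Fin n → ℝ) → ℂ} (hf : Continuous f) (j : Fin n → ℤ) :
    IntegrableOn (fun x => f x * (boxSine L j x : ℂ)) (Set.Icc 0 L) :=
  (hf.mul (Complex.continuous_ofReal.comp (continuous_boxSine L j))).continuousOn.integrableOn_compact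
    isCompact_Icc

theorem boxCoeff_eq_zero_of_index (f : (Fin n → ℝ) → ℂ) {j : Fin n → ℤ} (hj : ∃ i, j i = 0) :
    boxCoeff L f j = 0 := by
  obtain ⟨i, hi⟩ := hj
  have h (x : Fin n → ℝ) : boxSine L j x = 0 :=
    Finset.prod_eq_zero (Finset.mem_univ i) (by simp [boxFreq, hi])
  simp [boxCoeff, h]

theorem boxSine_eq_sign_mul (L : Fin n → ℝ) (j : Fin n → ℤ) (x : Fin n → ℝ) :
    boxSine L j x = (∏ i, ((j i).sign : ℝ)) * boxSine L (fun i => ((j i).natAbs : ℤ)) x := by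
  rw [boxSine, boxSine, ← Finset.prod_mul_distrib]
  refine Finset.prod_congr rfl fun i _ => ?_
  simp only [boxFreq]
  rcases lt_trichotomy (j i) 0 with h | h | h
  · rw [Int.sign_eq_neg_one_of_neg h, Int.ofNat_natAbs_of_nonpos h.le, Int.cast_neg, Int.cast_neg,
      Int.cast_one, neg_one_mul, ← Real.sin_neg]
    ring_nf
  · simp [h]
  · rw [Int.sign_eq_one_of_pos h, Int.natAbs_of_nonneg h.le, Int.cast_one, one_mul]

theorem boxCoeff_eq_sign_mul (L : Fin n → ℝ) (f : (Fin n → ℝ) → ℂ) (j : Fin n → ℤ) :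
    boxCoeff L f j = (∏ i, ((j i).sign : ℂ)) * boxCoeff L f (fun i => ((j i).natAbs : ℤ)) := by
  rw [boxCoeff, boxCoeff, ← integral_const_mul]
  congr 1
  funext x
  rw [boxSine_eq_sign_mul]
  push_cast
  ring

theorem continuous_sineSeries {c : (Fin n → ℕ) → ℂ} (hc : Summable fun j => ‖c j‖) :
    Continuous fun x => ∑' j : Fin n → ℕ, c j * (boxSine L (fun i => (j i : ℤ)) x : ℂ) := by
  refine continuous_tsum (fun j => continuous_const.mul
    (Complex.continuous_ofReal.comp (continuous_boxSine L _))) hc fun j x => ?_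
  rw [norm_mul, Complex.norm_real]
  exact mul_le_of_le_one_right (norm_nonneg _) (abs_boxSine_le_one L _ x)

/-- The sine coefficients of an absolutely convergent sine series. -/
theorem boxCoeff_sineSeries (hL : ∀ i, 0 < L i) {c : (Fin n → ℕ) → ℂ}
    (hc : Summable fun j => ‖c j‖) (l : Fin n → ℕ) (hl : ∀ i, l i ≠ 0) :
    boxCoeff L (fun x => ∑' j : Fin n → ℕ, c j * (boxSine L (fun i => (j i : ℤ)) x : ℂ))
      (fun i => (l i : ℤ)) = c l * ∏ i, ((L i / 2 : ℝ) : ℂ) := by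
  have hterm (j : Fin n → ℕ) :
      ∫ x in Set.Icc 0 L, c j * (boxSine L (fun i => (j i : ℤ)) x : ℂ) *
        (boxSine L (fun i => (l i : ℤ)) x : ℂ) =
        if j = l then c l * ∏ i, ((L i / 2 : ℝ) : ℂ) else 0 := by
    simp only [mul_assoc, ← Complex.ofReal_mul]
    rw [integral_const_mul, integral_complex_ofReal, setIntegral_boxSine_mul_boxSine hL]
    split_ifs with hjl
    · subst hjl
      rw [Complex.ofReal_prod]
      congr 1
      refine Finset.prod_congr rfl fun i _ => ?_
      have := hl i
      rw [if_pos (sub_self _), if_neg (by omega), sub_zero]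
    · obtain ⟨i, hi⟩ := Function.ne_iff.1 hjl
      rw [Finset.prod_eq_zero (Finset.mem_univ i), Complex.ofReal_zero, mul_zero]
      have := hl i
      rw [if_neg (by omega), if_neg (by omega), sub_zero, zero_div]
  have hbound (j : Fin n → ℕ) (x : Fin n → ℝ) :
      ‖c j * (boxSine L (fun i => (j i : ℤ)) x : ℂ) * (boxSine L (fun i => (l i : ℤ)) x : ℂ)‖ ≤
        ‖c j‖ := by
    rw [norm_mul, norm_mul, Complex.norm_real, Complex.norm_real]
    exact (mul_le_of_le_one_right (by positivity) (abs_boxSine_le_one L _ x)).trans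
      (mul_le_of_le_one_right (norm_nonneg _) (abs_boxSine_le_one L _ x))
  have hsum := hasSum_integral_of_dominated_convergence (μ := volume.restrict (Set.Icc 0 L))
    (F := fun (j : Fin n → ℕ) x => c j * (boxSine L (fun i => (j i : ℤ)) x : ℂ) *
      (boxSine L (fun i => (l i : ℤ)) x : ℂ)) (fun j _ => ‖c j‖)
    (fun j => (integrableOn_box_mul_boxSine (continuous_const.mul
      (Complex.continuous_ofReal.comp (continuous_boxSine L _))) _).aestronglyMeasurable)
    (fun j => Eventually.of_forall (hbound j)) (Eventually.of_forall fun _ => hc)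
    (integrableOn_const isCompact_Icc.measure_lt_top.ne)
    (Eventually.of_forall fun x => (Summable.of_norm_bounded hc fun j => hbound j x).hasSum)
  simp only [hterm, tsum_mul_right] at hsum
  rw [boxCoeff, ← hsum.tsum_eq, tsum_ite_eq]

/-- A continuous function with absolutely summable Dirichlet sine coefficients is the sum of its
sine series in the open box. -/
theorem tsum_boxCoeff_mul_boxSine (hL : ∀ i, 0 < L i) {f : (Fin n → ℝ) → ℂ} (hf : Continuous f)
    (hsum : Summable fun j : Fin n → ℕ => ‖boxCoeff L f fun i => (j i : ℤ)‖) {x : Fin n → ℝ}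
    (hx : x ∈ Set.univ.pi fun i => Set.Ioo 0 (L i)) :
    ∑' j : Fin n → ℕ, (∏ i, ((L i / 2 : ℝ) : ℂ))⁻¹ * boxCoeff L f (fun i => (j i : ℤ)) *
      (boxSine L (fun i => (j i : ℤ)) x : ℂ) = f x := by
  have hw : ∏ i, ((L i / 2 : ℝ) : ℂ) ≠ 0 :=
    Finset.prod_ne_zero_iff.2 fun i _ => Complex.ofReal_ne_zero.2 (half_pos (hL i)).ne'
  have hc : Summable fun j : Fin n → ℕ =>
      ‖(∏ i, ((L i / 2 : ℝ) : ℂ))⁻¹ * boxCoeff L f (fun i => (j i : ℤ))‖ := by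
    simpa only [norm_mul] using hsum.mul_left _
  have hF := continuous_sineSeries (L := L) hc
  refine sub_eq_zero.1 (eq_zero_of_boxCoeff_eq_zero hL (hF.sub hf) (fun l => ?_) hx)
  have hsub : boxCoeff L (fun x => (∑' j : Fin n → ℕ, (∏ i, ((L i / 2 : ℝ) : ℂ))⁻¹ *
      boxCoeff L f (fun i => (j i : ℤ)) * (boxSine L (fun i => (j i : ℤ)) x : ℂ)) - f x) l =
      boxCoeff L (fun x => ∑' j : Fin n → ℕ, (∏ i, ((L i / 2 : ℝ) : ℂ))⁻¹ *
        boxCoeff L f (fun i => (j i : ℤ)) * (boxSine L (fun i => (j i : ℤ)) x : ℂ)) l -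
      boxCoeff L f l := by
    simp only [boxCoeff, sub_mul]
    exact integral_sub (integrableOn_box_mul_boxSine hF l) (integrableOn_box_mul_boxSine hf l)
  by_cases hl : ∃ i, l i = 0
  · exact boxCoeff_eq_zero_of_index _ hl
  · push Not at hl
    refine hsub.trans ?_
    rw [boxCoeff_eq_sign_mul, boxCoeff_eq_sign_mul L f,
      boxCoeff_sineSeries hL hc (fun i => (l i).natAbs) fun i => Int.natAbs_ne_zero.2 (hl i)]
    field_simp
    ring

end SineSeries

section Summability

/-- A product over a finite type of summable nonnegative sequences is summable. -/
theorem summable_prod_pi {ι : Type*} [Fintype ι] [DecidableEq ι] {f : ι → ℕ → ℝ}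
    (hf : ∀ i k, 0 ≤ f i k) (hs : ∀ i, Summable (f i)) :
    Summable fun J : ι → ℕ => ∏ i, f i (J i) := by
  refine summable_of_sum_le (c := ∏ i, ∑' k, f i k)
    (fun J => Finset.prod_nonneg fun i _ => hf i _) fun s => ?_
  calc ∑ J ∈ s, ∏ i, f i (J i)
      ≤ ∑ J ∈ Fintype.piFinset fun i => s.image fun J => J i, ∏ i, f i (J i) :=
        Finset.sum_le_sum_of_subset_of_nonneg
          (fun J hJ => Fintype.mem_piFinset.2 fun i => Finset.mem_image_of_mem _ hJ)
          fun J _ _ => Finset.prod_nonneg fun i _ => hf i _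
    _ = ∏ i, ∑ k ∈ s.image fun J => J i, f i k := (Finset.prod_univ_sum _ _).symm
    _ ≤ ∏ i, ∑' k, f i k := Finset.prod_le_prod
        (fun i _ => Finset.sum_nonneg fun k _ => hf i k)
        fun i _ => (hs i).sum_le_tsum _ fun k _ => hf i k

variable {n : ℕ} {L : Fin n → ℝ}

theorem summable_exp_neg_half_boxEigenvalue (hL : ∀ i, 0 < L i) :
    Summable fun J : Fin n → ℕ => Real.exp (-boxEigenvalue L (fun i => (J i : ℤ)) / 2) := by
  have hprod : ∀ J : Fin n → ℕ, Real.exp (-boxEigenvalue L (fun i => (J i : ℤ)) / 2) =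
      ∏ i, Real.exp (-((Real.pi / L i) ^ 2 / 2) * (J i : ℝ) ^ 2) := by
    intro J
    rw [← Real.exp_sum, boxEigenvalue, ← Finset.sum_neg_distrib, Finset.sum_div]
    refine congrArg _ (Finset.sum_congr rfl fun i _ => ?_)
    rw [boxFreq]
    push_cast
    ring
  simp_rw [hprod]
  refine summable_prod_pi (f := fun i k => Real.exp (-((Real.pi / L i) ^ 2 / 2) * (k : ℝ) ^ 2))
    (fun i k => (Real.exp_pos _).le) fun i => ?_
  have hc : 0 < (Real.pi / L i) ^ 2 / 2 := by have := hL i; positivity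
  refine Summable.of_nonneg_of_le (fun k => (Real.exp_pos _).le) (fun k => ?_)
    (Real.summable_exp_nat_mul_iff.2 (neg_neg_of_pos hc))
  refine Real.exp_le_exp.2 ?_
  have hk : (k : ℝ) ≤ (k : ℝ) ^ 2 := mod_cast Nat.le_self_pow two_ne_zero k
  nlinarith

/-- The exponential decay in the eigenvalue beats any power of the frequencies. -/
theorem summable_exp_neg_boxEigenvalue_mul_pow (hL : ∀ i, 0 < L i) (k : ℕ) :
    Summable fun J : Fin n → ℕ => Real.exp (-boxEigenvalue L (fun i => (J i : ℤ))) *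
      (1 + (boxEigenvalue L (fun i => (J i : ℤ)) + ∑ i, |boxFreq L (fun i => (J i : ℤ)) i|)) ^ k := by
  refine Summable.of_nonneg_of_le (fun J => ?_) (fun J => ?_)
    ((summable_exp_neg_half_boxEigenvalue hL).mul_left
      (4 ^ k * (k.factorial : ℝ) * Real.exp ((n + 1) / 4)))
  · have := boxEigenvalue_nonneg L (fun i => (J i : ℤ))
    positivity
  · set j : Fin n → ℤ := fun i => (J i : ℤ)
    have hl := boxEigenvalue_nonneg L j
    have hs : 0 ≤ ∑ i, |boxFreq L j i| := Finset.sum_nonneg fun i _ => abs_nonneg _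
    have hle : ∑ i, |boxFreq L j i| ≤ n + boxEigenvalue L j := by
      calc ∑ i, |boxFreq L j i| ≤ ∑ i, (1 + boxFreq L j i ^ 2) :=
            Finset.sum_le_sum fun i _ => by
              nlinarith [sq_abs (boxFreq L j i), sq_nonneg (|boxFreq L j i| - 1)]
        _ = n + boxEigenvalue L j := by simp [Finset.sum_add_distrib, boxEigenvalue]
    set R := 1 + (boxEigenvalue L j + ∑ i, |boxFreq L j i|) with hR
    have hpow : R ^ k ≤ 4 ^ k * k.factorial * Real.exp (R / 4) := by
      have h := Real.pow_div_factorial_le_exp (x := R / 4) (by positivity) k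
      rw [div_le_iff₀ (by positivity), div_pow, div_le_iff₀ (by positivity)] at h
      linarith
    calc Real.exp (-boxEigenvalue L j) * R ^ k
        ≤ Real.exp (-boxEigenvalue L j) * (4 ^ k * k.factorial * Real.exp (R / 4)) := by gcongr
      _ = 4 ^ k * k.factorial * Real.exp (-boxEigenvalue L j + R / 4) := by
          rw [Real.exp_add]; ring
      _ ≤ 4 ^ k * k.factorial * Real.exp ((n + 1) / 4 + -boxEigenvalue L j / 2) := by
          refine mul_le_mul_of_nonneg_left (Real.exp_le_exp.2 ?_) (by positivity)
          linarith
      _ = _ := by rw [Real.exp_add]; ring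

end Summability

section Decay

variable {n : ℕ} {L : Fin n → ℝ}

theorem norm_boxCoeff_le {f : (Fin n → ℝ) → ℂ} (hf : Continuous f) (j : Fin n → ℤ) :
    ‖boxCoeff L f j‖ ≤ ∫ x in Set.Icc 0 L, ‖f x‖ := by
  refine norm_integral_le_of_norm_le (hf.norm.continuousOn.integrableOn_compact isCompact_Icc)
    (ae_of_all _ fun x => ?_)
  rw [norm_mul, Complex.norm_real, Real.norm_eq_abs]
  exact mul_le_of_le_one_right (norm_nonneg _) (abs_boxSine_le_one L j x)

/-- Since solutions exist for all past times, their sine coefficients decay faster than any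
exponential of the eigenvalue. -/
theorem exists_norm_boxCoeff_le (hL : ∀ i, 0 < L i) {u : ℝ × (Fin n → ℝ) → ℂ}
    (hu : ContDiff ℝ (⊤ : ℕ∞) u)
    (hheat : ∀ t, ∀ x ∈ Set.Icc 0 L, dT u (t, x) = ∑ i, dX i (dX i u) (t, x))
    (hbc : ∀ t, ∀ x ∈ Set.Icc 0 L, (∃ i, x i = 0 ∨ x i = L i) → u (t, x) = 0) (t T : ℝ) :
    ∃ C : ℝ, 0 ≤ C ∧ ∀ j : Fin n → ℤ,
      ‖boxCoeff L (fun x => u (t, x)) j‖ ≤ C * Real.exp (-boxEigenvalue L j * T) := by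
  refine ⟨∫ x in Set.Icc 0 L, ‖u (t - T, x)‖, integral_nonneg fun _ => norm_nonneg _,
    fun j => ?_⟩
  rw [boxCoeff_heat hL hu hheat hbc j (t - T) t, norm_mul, Complex.norm_real, Real.norm_eq_abs,
    Real.abs_exp, mul_comm, sub_sub_cancel]
  gcongr
  exact norm_boxCoeff_le (hu.continuous.comp (by fun_prop)) j

theorem summable_norm_boxCoeff (hL : ∀ i, 0 < L i) {u : ℝ × (Fin n → ℝ) → ℂ}
    (hu : ContDiff ℝ (⊤ : ℕ∞) u)
    (hheat : ∀ t, ∀ x ∈ Set.Icc 0 L, dT u (t, x) = ∑ i, dX i (dX i u) (t, x))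
    (hbc : ∀ t, ∀ x ∈ Set.Icc 0 L, (∃ i, x i = 0 ∨ x i = L i) → u (t, x) = 0) (t : ℝ) :
    Summable fun J : Fin n → ℕ => ‖boxCoeff L (fun x => u (t, x)) fun i => (J i : ℤ)‖ := by
  obtain ⟨C, -, hC⟩ := exists_norm_boxCoeff_le hL hu hheat hbc t 1
  refine Summable.of_nonneg_of_le (fun _ => norm_nonneg _) (fun J => hC _) (Summable.mul_left C ?_)
  simpa using summable_exp_neg_boxEigenvalue_mul_pow hL 0

/-- The sine series of a solution converges to it on the open box, at all times. -/
theorem tsum_boxCoeff_mul_boxHeatBasis (hL : ∀ i, 0 < L i) {u : ℝ × (Fin n → ℝ) → ℂ}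
    (hu : ContDiff ℝ (⊤ : ℕ∞) u)
    (hheat : ∀ t, ∀ x ∈ Set.Icc 0 L, dT u (t, x) = ∑ i, dX i (dX i u) (t, x))
    (hbc : ∀ t, ∀ x ∈ Set.Icc 0 L, (∃ i, x i = 0 ∨ x i = L i) → u (t, x) = 0)
    (p : ℝ × (Fin n → ℝ)) (hp : p.2 ∈ Set.univ.pi fun i => Set.Ioo 0 (L i)) :
    ∑' J : Fin n → ℕ, (∏ i, ((L i / 2 : ℝ) : ℂ))⁻¹ *
      boxCoeff L (fun x => u (0, x)) (fun i => (J i : ℤ)) *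
        boxHeatBasis L (fun i => (J i : ℤ)) p = u p := by
  rw [← tsum_boxCoeff_mul_boxSine hL (f := fun x => u (p.1, x))
    (hu.continuous.comp (by fun_prop)) (summable_norm_boxCoeff hL hu hheat hbc p.1) hp]
  refine tsum_congr fun J => ?_
  rw [boxHeatBasis_eq, boxCoeff_heat hL hu hheat hbc _ 0 p.1, sub_zero]
  push_cast
  ring

end Decay

section Cutoff

theorem exists_time_cutoff (T : ℝ) (hT : 0 < T) : ∃ h : ℝ → ℂ, ContDiff ℝ (⊤ : ℕ∞) h ∧
    (∀ t, |t| ≤ T → h t = 1) ∧ (∀ t, T + 1 < |t| → h =ᶠ[𝓝 t] 0) ∧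
    ∀ m : ℕ, ∃ M : ℝ, 0 ≤ M ∧ ∀ k ≤ m, ∀ t, ‖iteratedDeriv k h t‖ ≤ M := by
  let χ : ContDiffBump (0 : ℝ) := ⟨T, T + 1, hT, by linarith⟩
  have hsupp : tsupport (fun t => (χ t : ℂ)) ⊆ Metric.closedBall 0 (T + 1) :=
    (closure_mono (Function.support_comp_subset (g := fun r : ℝ => (r : ℂ)) (by simp) χ)).trans
      χ.tsupport_eq.subset
  have hdiff : ContDiff ℝ (⊤ : ℕ∞) fun t => (χ t : ℂ) :=
    Complex.ofRealCLM.contDiff.comp χ.contDiff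
  have hcomp : HasCompactSupport fun t => (χ t : ℂ) :=
    (isCompact_closedBall _ _).of_isClosed_subset (isClosed_tsupport _) hsupp
  refine ⟨fun t => (χ t : ℂ), hdiff, fun t ht => ?_, fun t ht => ?_, fun m => ?_⟩
  · simp [χ.one_of_mem_closedBall (show t ∈ Metric.closedBall 0 χ.rIn by simpa using ht)]
  · refine notMem_tsupport_iff_eventuallyEq.1 fun h => ?_
    have := hsupp h
    rw [mem_closedBall_zero_iff, Real.norm_eq_abs] at this
    exact absurd this (not_le.2 ht)
  · have hbound : ∀ k : ℕ, ∃ C, ∀ t, ‖iteratedDeriv k (fun t => (χ t : ℂ)) t‖ ≤ C := by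
      intro k
      obtain ⟨C, hC⟩ := (hcomp.iteratedFDeriv (𝕜 := ℝ) k).exists_bound_of_continuous
        (hdiff.continuous_iteratedFDeriv (mod_cast le_top))
      exact ⟨C, fun t => by rw [← norm_iteratedFDeriv_eq_norm_iteratedDeriv]; exact hC t⟩
    choose C hC using hbound
    refine ⟨∑ k ∈ Finset.range (m + 1), C k,
      Finset.sum_nonneg fun k _ => (norm_nonneg _).trans (hC k 0), fun k hk t => (hC k t).trans ?_⟩
    exact Finset.single_le_sum (fun k _ => (norm_nonneg _).trans (hC k 0))
      (Finset.mem_range.2 (Nat.lt_succ_of_le hk))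

theorem norm_iteratedFDeriv_cutoff_mul_boxHeatBasis_le {n : ℕ} (L : Fin n → ℝ) (j : Fin n → ℤ)
    {h : ℝ → ℂ} (hh : ContDiff ℝ (⊤ : ℕ∞) h) {S M : ℝ} (hM : 0 ≤ M)
    (hzero : ∀ t, S < |t| → h =ᶠ[𝓝 t] 0) {m : ℕ}
    (hb : ∀ k ≤ m, ∀ t, ‖iteratedDeriv k h t‖ ≤ M) {k : ℕ} (hk : k ≤ m)
    (p : ℝ × (Fin n → ℝ)) :
    ‖iteratedFDeriv ℝ k (fun q : ℝ × (Fin n → ℝ) => h q.1 * boxHeatBasis L j q) p‖ ≤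
      M * Real.exp (boxEigenvalue L j * S) *
        (1 + (boxEigenvalue L j + ∑ i, |boxFreq L j i|)) ^ k := by
  have hl := boxEigenvalue_nonneg L j
  have hs : 0 ≤ ∑ i, |boxFreq L j i| := Finset.sum_nonneg fun i _ => abs_nonneg _
  rcases le_or_gt |p.1| S with hp | hp
  · have htime : ∀ k ≤ m,
        ‖iteratedFDeriv ℝ k (fun q : ℝ × (Fin n → ℝ) => h q.1) p‖ ≤ M * 1 ^ k := fun k hk => by
      rw [one_pow, mul_one]
      exact (norm_iteratedFDeriv_comp_functional_le hh (ContinuousLinearMap.fst ℝ ℝ (Fin n → ℝ))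
        (ContinuousLinearMap.norm_fst_le ..) k p).trans (hb k hk _)
    have hsmooth : ContDiff ℝ (⊤ : ℕ∞) fun q : ℝ × (Fin n → ℝ) => h q.1 := hh.comp contDiff_fst
    have hmul := norm_iteratedFDeriv_mul_le_geometric hsmooth (contDiff_boxHeatBasis L j) hM
      zero_le_one htime (fun k _ => norm_iteratedFDeriv_boxHeatBasis_le L j p k) k hk
    refine hmul.trans ?_
    have hexp : Real.exp (-boxEigenvalue L j * p.1) ≤ Real.exp (boxEigenvalue L j * S) :=
      Real.exp_le_exp.2 (by nlinarith [neg_le_of_abs_le hp])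
    gcongr
  · have hloc : (fun q : ℝ × (Fin n → ℝ) => h q.1 * boxHeatBasis L j q) =ᶠ[𝓝 p] fun _ => 0 := by
      filter_upwards [continuousAt_fst.eventually (hzero p.1 hp)] with q hq
      rw [hq, Pi.zero_apply, zero_mul]
    rw [(hloc.iteratedFDeriv ℝ k).eq_of_nhds, iteratedFDeriv_fun_zero]
    simp only [Pi.zero_apply, norm_zero]
    positivity

end Cutoff

section Density

variable {n : ℕ} {L : Fin n → ℝ}

/-- Approximation, on a bounded time interval and on the closed box, of a solution and its
derivatives by the partial sums of its sine series. -/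
theorem exists_finset_norm_iteratedFDeriv_sub_le (hL : ∀ i, 0 < L i) {u : ℝ × (Fin n → ℝ) → ℂ}
    (hu : ContDiff ℝ (⊤ : ℕ∞) u)
    (hheat : ∀ t, ∀ x ∈ Set.Icc 0 L, dT u (t, x) = ∑ i, dX i (dX i u) (t, x))
    (hbc : ∀ t, ∀ x ∈ Set.Icc 0 L, (∃ i, x i = 0 ∨ x i = L i) → u (t, x) = 0)
    {T : ℝ} (hT : 0 < T) (m : ℕ) {ε : ℝ} (hε : 0 < ε) :
    ∃ (s : Finset (Fin n → ℕ)) (c : (Fin n → ℕ) → ℂ), ∀ k ≤ m, ∀ p : ℝ × (Fin n → ℝ),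
      |p.1| ≤ T → p.2 ∈ Set.Icc 0 L →
        ‖iteratedFDeriv ℝ k
          (fun q => u q - ∑ J ∈ s, c J * boxHeatBasis L (fun i => (J i : ℤ)) q) p‖ ≤ ε := by
  obtain ⟨h, hh, hone, hzero, hbound⟩ := exists_time_cutoff T hT
  obtain ⟨M, hM, hMb⟩ := hbound m
  obtain ⟨C, hC, hCb⟩ := exists_norm_boxCoeff_le hL hu hheat hbc 0 (T + 2)
  set c : (Fin n → ℕ) → ℂ := fun J => (∏ i, ((L i / 2 : ℝ) : ℂ))⁻¹ *
    boxCoeff L (fun x => u (0, x)) (fun i => (J i : ℤ)) with hc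
  let f : (Fin n → ℕ) → ℝ × (Fin n → ℝ) → ℂ :=
    fun J => c J • fun q => h q.1 * boxHeatBasis L (fun i => (J i : ℤ)) q
  have hbase : ∀ J : Fin n → ℕ, ContDiff ℝ (⊤ : ℕ∞)
      fun q : ℝ × (Fin n → ℝ) => h q.1 * boxHeatBasis L (fun i => (J i : ℤ)) q :=
    fun J => (hh.comp contDiff_fst).mul (contDiff_boxHeatBasis L _)
  have hf : ∀ J, ContDiff ℝ (⊤ : ℕ∞) (f J) := fun J => contDiff_const.smul (hbase J)
  have hm : ((m : ℕ∞) : WithTop ℕ∞) ≤ ((⊤ : ℕ∞) : WithTop ℕ∞) := mod_cast le_top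
  let A : ℝ := ‖(∏ i, ((L i / 2 : ℝ) : ℂ))⁻¹‖ * C * M
  let v : ℕ → (Fin n → ℕ) → ℝ := fun k J => A * (Real.exp (-boxEigenvalue L (fun i => (J i : ℤ))) *
    (1 + (boxEigenvalue L (fun i => (J i : ℤ)) + ∑ i, |boxFreq L (fun i => (J i : ℤ)) i|)) ^ k)
  have hv : ∀ k, Summable (v k) := fun k =>
    (summable_exp_neg_boxEigenvalue_mul_pow hL k).mul_left A
  have hfv : ∀ k ≤ m, ∀ J p, ‖iteratedFDeriv ℝ k (f J) p‖ ≤ v k J := by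
    intro k hk J p
    set j : Fin n → ℤ := fun i => (J i : ℤ) with hj
    have hl := boxEigenvalue_nonneg L j
    have hs : 0 ≤ ∑ i, |boxFreq L j i| := Finset.sum_nonneg fun i _ => abs_nonneg _
    rw [iteratedFDeriv_const_smul_apply ((hbase J).contDiffAt.of_le (mod_cast le_top)), norm_smul]
    calc ‖c J‖ * _ ≤ (‖(∏ i, ((L i / 2 : ℝ) : ℂ))⁻¹‖ *
          (C * Real.exp (-boxEigenvalue L j * (T + 2)))) *
          (M * Real.exp (boxEigenvalue L j * (T + 1)) *
            (1 + (boxEigenvalue L j + ∑ i, |boxFreq L j i|)) ^ k) := by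
          rw [hc, norm_mul]
          gcongr
          · exact hCb j
          · exact norm_iteratedFDeriv_cutoff_mul_boxHeatBasis_le L j hh hM hzero hMb hk p
      _ = A * ((Real.exp (-boxEigenvalue L j * (T + 2)) *
            Real.exp (boxEigenvalue L j * (T + 1))) *
            (1 + (boxEigenvalue L j + ∑ i, |boxFreq L j i|)) ^ k) := by
          simp only [A]; ring
      _ = v k J := by
          rw [← Real.exp_add]
          simp only [v, ← hj]
          congr 4
          ring
  have hfv' : ∀ (k : ℕ) (J : Fin n → ℕ) (p : ℝ × (Fin n → ℝ)), (k : ℕ∞) ≤ (m : ℕ∞) →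
      ‖iteratedFDeriv ℝ k (f J) p‖ ≤ v k J := fun k J p hk => hfv k (mod_cast hk) J p
  have hG : ContDiff ℝ (m : ℕ∞) fun p => ∑' J, f J p :=
    contDiff_tsum (fun J => (hf J).of_le hm) (fun k _ => hv k) hfv'
  have happrox : ∀ᶠ s : Finset (Fin n → ℕ) in atTop, ∀ k ∈ Finset.range (m + 1), ∀ p,
      dist (∑' J, iteratedFDeriv ℝ k (f J) p) (∑ J ∈ s, iteratedFDeriv ℝ k (f J) p) < ε :=
    (Filter.eventually_all_finset _).2 fun k hk => Metric.tendstoUniformly_iff.1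
      (tendstoUniformly_tsum (hv k) fun J p =>
        hfv k (Nat.lt_succ_iff.1 (Finset.mem_range.1 hk)) J p) ε hε
  obtain ⟨s, hs⟩ := happrox.exists
  refine ⟨s, c, fun k hk p hp hpx => ?_⟩
  let g : ℝ × (Fin n → ℝ) → ℂ := (fun p => ∑' J, f J p) - fun p => ∑ J ∈ s, f J p
  let w : ℝ × (Fin n → ℝ) → ℂ :=
    fun q => u q - ∑ J ∈ s, c J * boxHeatBasis L (fun i => (J i : ℤ)) q
  have hsum : ContDiff ℝ (m : ℕ∞) fun p => ∑ J ∈ s, f J p :=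
    ContDiff.sum fun J _ => (hf J).of_le hm
  have hg : ContDiff ℝ (m : ℕ∞) g := hG.sub hsum
  have hw : ContDiff ℝ (m : ℕ∞) w := (hu.of_le hm).sub
    (ContDiff.sum fun J _ => contDiff_const.mul (contDiff_boxHeatBasis L _))
  have hk' : ((k : ℕ) : WithTop ℕ∞) ≤ ((m : ℕ∞) : WithTop ℕ∞) := mod_cast hk
  let V : Set (ℝ × (Fin n → ℝ)) := Set.Ioo (-T) T ×ˢ Set.univ.pi fun i => Set.Ioo 0 (L i)
  have hV : IsOpen V := isOpen_Ioo.prod (isOpen_set_pi Set.finite_univ fun _ _ => isOpen_Ioo)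
  have hwg : Set.EqOn w g V := by
    rintro q ⟨hqt, hqx⟩
    have hq : h q.1 = 1 := hone _ (abs_le.2 ⟨hqt.1.le, hqt.2.le⟩)
    simp only [w, g, f, Pi.sub_apply, Pi.smul_apply, smul_eq_mul, hq, one_mul]
    rw [← tsum_boxCoeff_mul_boxHeatBasis hL hu hheat hbc q hqx]
  have hderiv : Set.EqOn (iteratedFDeriv ℝ k w) (iteratedFDeriv ℝ k g) V := fun q hq =>
    ((hwg.eventuallyEq_of_mem (hV.mem_nhds hq)).iteratedFDeriv ℝ k).eq_of_nhds
  have hmem : p ∈ closure V := by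
    rw [closure_prod_eq, closure_pi_set, closure_Ioo (by linarith)]
    refine ⟨abs_le.1 hp, fun i _ => ?_⟩
    simp only [closure_Ioo (hL i).ne]
    exact ⟨hpx.1 i, hpx.2 i⟩
  have heq : iteratedFDeriv ℝ k w p = iteratedFDeriv ℝ k g p :=
    hderiv.closure (hw.continuous_iteratedFDeriv hk') (hg.continuous_iteratedFDeriv hk') hmem
  change ‖iteratedFDeriv ℝ k w p‖ ≤ ε
  rw [heq, iteratedFDeriv_sub_apply (hG.of_le hk').contDiffAt (hsum.of_le hk').contDiffAt,
    iteratedFDeriv_fun_sum_apply fun J _ => ((hf J).of_le (hk'.trans hm)).contDiffAt,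
    iteratedFDeriv_tsum (fun J => (hf J).of_le hm) (fun k _ => hv k) hfv' (mod_cast hk),
    ← dist_eq_norm]
  exact (hs k (Finset.mem_range.2 (Nat.lt_succ_of_le hk)) p).le

end Density

/-- The separated Fourier basis has dense span in the smooth solutions of the heat equation
on a box with homogeneous Dirichlet boundary conditions on all faces. -/
theorem bepgp_heat_box_dirichlet_dense
    (n : ℕ) (hn : 1 ≤ n) (L : Fin n → ℝ) (hL : ∀ i, 0 < L i)
    (u : ℝ × (Fin n → ℝ) → ℂ) (hu : ContDiff ℝ (⊤ : ℕ∞) u)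
    (hheat : ∀ (t : ℝ) (x : Fin n → ℝ), (∀ i, 0 ≤ x i ∧ x i ≤ L i) →
      dT u (t, x) = ∑ i, dX i (dX i u) (t, x))
    (hbc : ∀ (t : ℝ) (x : Fin n → ℝ), (∀ h, 0 ≤ x h ∧ x h ≤ L h) →
      (∃ i, x i = 0 ∨ x i = L i) → u (t, x) = 0)
    (K : Set (ℝ × (Fin n → ℝ))) (hKc : IsCompact K)
    (hK : K ⊆ Set.univ ×ˢ (Set.univ.pi fun i => Set.Icc 0 (L i)))
    (m : ℕ) (ε : ℝ) (hε : 0 < ε) :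
    ∃ (r : ℕ) (j : Fin r → (Fin n → ℤ)) (c : Fin r → ℂ),
      ∀ k ≤ m, ∀ p ∈ K,
        ‖iteratedFDeriv ℝ k
            (fun q => u q - ∑ h, c h * boxHeatBasis L (j h) q) p‖ ≤ ε := by
  obtain ⟨T, hT, hKT⟩ := (hKc.image continuous_fst).isBounded.exists_pos_norm_le
  have hbox : ∀ x : Fin n → ℝ, x ∈ Set.Icc 0 L → ∀ i, 0 ≤ x i ∧ x i ≤ L i :=
    fun x hx i => ⟨hx.1 i, hx.2 i⟩
  obtain ⟨s, c, hs⟩ := exists_finset_norm_iteratedFDeriv_sub_le hL hu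
    (fun t x hx => hheat t x (hbox x hx)) (fun t x hx => hbc t x (hbox x hx)) hT m hε
  refine ⟨s.card, fun h i => ((s.equivFin.symm h).1 i : ℤ), fun h => c (s.equivFin.symm h).1,
    fun k hk p hp => ?_⟩
  have hp2 : p.2 ∈ Set.Icc 0 L :=
    ⟨fun i => ((hK hp).2 i (Set.mem_univ i)).1, fun i => ((hK hp).2 i (Set.mem_univ i)).2⟩
  convert hs k hk p (hKT _ (Set.mem_image_of_mem _ hp)) hp2 using 5 with q
  rw [← Finset.sum_coe_sort s, ← s.equivFin.symm.sum_comp]
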